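/- Let m = 4 and ℳ = (4^{i−1})_{i≥1}. For all integers k ≥ 1 and n ≥ 0, writing c_j = ⌊n/4^j⌋ mod 4 for the j-th base-4 digit of n: p_ℳ(n,k) ≡ 1 (mod 4) if and only if c_j ∈ {0,2} for all 1 ≤ j ≤ k−1 and the number of indices j ∈ {1,…,k−1} with c_j = 2 is even; p_ℳ(n,k) ≡ 3 (mod 4) if and only if c_j ∈ {0,2} for all 1 ≤ j ≤ k−1 and the number of indices j ∈ {1,…,k−1} with c_j = 2 is odd; and p_ℳ(n,k) ≡ 2 (mod 4) if and only if there is exactly one index j ∈ {1,…,k−1} with c_j = 1 and c_j ∈ {0,2} for all other indices j ∈ {1,…,k−1}. -/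

import Mathlib

/-- `pM m k n` is the number of restricted `m`-ary partitions of `n` with parts
`1, m, m^2, …, m^(k-1)`. -/
noncomputable def pM (m k n : ℕ) : ℕ :=
  Nat.card {x : Fin k → ℕ // ∑ i : Fin k, x i * m ^ (i : ℕ) = n}

/-- The solutions counted by `pM` form a finite type as soon as every part is positive. -/
theorem finite_pM {m : ℕ} (hm : 0 < m) (k n : ℕ) :
    Finite {x : Fin k → ℕ // ∑ i : Fin k, x i * m ^ (i : ℕ) = n} := by
  refine Set.Finite.subset (Set.finite_Iic (fun _ : Fin k => n)) ?_
  intro x (hx : ∑ i : Fin k, x i * m ^ (i : ℕ) = n) i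
  calc x i ≤ x i * m ^ (i : ℕ) := Nat.le_mul_of_pos_right _ (pow_pos hm _)
    _ ≤ ∑ i : Fin k, x i * m ^ (i : ℕ) :=
      Finset.single_le_sum (f := fun i : Fin k => x i * m ^ (i : ℕ))
        (fun _ _ => Nat.zero_le _) (Finset.mem_univ i)
    _ = n := hx

theorem sum_mul_pow_succ (m k : ℕ) (x : Fin (k + 1) → ℕ) :
    ∑ i : Fin (k + 1), x i * m ^ (i : ℕ) =
      x 0 + m * ∑ i : Fin k, x i.succ * m ^ (i : ℕ) := by
  rw [Fin.sum_univ_succ, Finset.mul_sum]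
  simp only [Fin.val_zero, pow_zero, mul_one, Fin.val_succ]
  congr 1
  exact Finset.sum_congr rfl fun i _ => by ring

theorem sigma_pM_ext {m k N : ℕ}
    {a b : Σ y : Fin N, {x : Fin k → ℕ // ∑ i : Fin k, x i * m ^ (i : ℕ) = y}}
    (h : a.2.1 = b.2.1) : a = b := by
  obtain ⟨⟨y, hy⟩, ⟨x, hx⟩⟩ := a
  obtain ⟨⟨z, hz⟩, ⟨w, hw⟩⟩ := b
  obtain rfl : x = w := h
  obtain rfl : _ = y := hx
  obtain rfl : _ = z := hw
  rfl

/-- Splitting off the number of parts equal to `1`. -/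
def pMSuccEquiv {m : ℕ} (hm : 0 < m) (k n : ℕ) :
    {x : Fin (k + 1) → ℕ // ∑ i : Fin (k + 1), x i * m ^ (i : ℕ) = n} ≃
      Σ y : Fin (n / m + 1), {x : Fin k → ℕ // ∑ i : Fin k, x i * m ^ (i : ℕ) = y} where
  toFun x := ⟨⟨∑ i : Fin k, x.1 i.succ * m ^ (i : ℕ), by
    have h := x.2
    rw [sum_mul_pow_succ] at h
    rw [Nat.lt_succ_iff, Nat.le_div_iff_mul_le hm, mul_comm]
    omega⟩, ⟨fun i => x.1 i.succ, rfl⟩⟩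
  invFun z := ⟨Fin.cons (n - m * z.1) z.2.1, by
    have h := Nat.lt_succ_iff.mp z.1.2
    rw [Nat.le_div_iff_mul_le hm, mul_comm] at h
    rw [sum_mul_pow_succ]
    simp only [Fin.cons_zero, Fin.cons_succ, z.2.2]
    omega⟩
  left_inv x := by
    have h := x.2
    rw [sum_mul_pow_succ] at h
    ext i
    refine Fin.cases ?_ (fun i => ?_) i
    · simp only [Fin.cons_zero]
      omega
    · simp only [Fin.cons_succ]
  right_inv _ := sigma_pM_ext (by simp only [Fin.cons_succ])

theorem pM_succ {m : ℕ} (hm : 0 < m) (k n : ℕ) :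
    pM m (k + 1) n = ∑ y ∈ Finset.range (n / m + 1), pM m k y := by
  have := fun y : Fin (n / m + 1) => finite_pM hm k y
  rw [pM, Nat.card_congr (pMSuccEquiv hm k n), Nat.card_sigma,
    ← Fin.sum_univ_eq_sum_range (pM m k)]
  rfl

theorem pM_one {m : ℕ} (hm : 0 < m) (n : ℕ) : pM m 1 n = 1 := by
  have h (y : ℕ) : pM m 0 y = if y = 0 then 1 else 0 := by
    by_cases hy : y = 0
    · simp [pM, hy]
    · simp [pM, hy, Ne.symm hy]
  simp [pM_succ hm, h]

/-- Complete blocks of length `m` cancel modulo `m`. -/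
theorem sum_range_div_modEq {m : ℕ} (hm : 0 < m) (g : ℕ → ℕ) (n : ℕ) :
    ∑ i ∈ Finset.range (n + 1), g (i / m) ≡ (n % m + 1) * g (n / m) [MOD m] := by
  induction n with
  | zero => simp [Nat.ModEq]
  | succ n ih =>
    rw [Finset.sum_range_succ]
    by_cases h : m ∣ n + 1
    · have hn : n % m + 1 = m := by
        rw [Nat.dvd_iff_mod_eq_zero, Nat.add_mod_eq_ite] at h
        have := Nat.mod_lt n hm
        rcases Nat.lt_or_ge 1 m with h1 | h1
        · rw [Nat.mod_eq_of_lt h1] at h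
          split_ifs at h
          omega
        · obtain rfl : m = 1 := by omega
          simp [Nat.mod_one]
      rw [hn] at ih
      rw [Nat.mod_eq_zero_of_dvd h, zero_add, one_mul]
      simpa using (ih.trans (Nat.modEq_zero_iff_dvd.mpr (dvd_mul_right _ _))).add_right
        (g ((n + 1) / m))
    · have hd : (n + 1) / m = n / m := by rw [Nat.succ_div, if_neg h, add_zero]
      have hr : (n + 1) % m = n % m + 1 := by
        have h1 := Nat.div_add_mod n m
        have h2 := Nat.div_add_mod (n + 1) m
        rw [hd] at h2
        omega
      rw [hd, hr, add_one_mul (n % m + 1)]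
      exact ih.add_right _

/-- The number of restricted `m`-ary partitions modulo `m`, in terms of base-`m` digits. -/
theorem pM_modEq_prod_digits {m : ℕ} (hm : 0 < m) (k n : ℕ) :
    pM m (k + 1) n ≡ ∏ j ∈ Finset.Icc 1 k, (n / m ^ j % m + 1) [MOD m] := by
  have hprod (k n : ℕ) : ∏ j ∈ Finset.Icc 1 k, (n / m ^ j % m + 1) =
      ∏ j ∈ Finset.range k, (n / m / m ^ j % m + 1) := by
    rw [Finset.range_eq_Ico, ← Finset.Ico_add_one_right_eq_Icc,
      Finset.prod_Ico_eq_prod_range, Finset.range_eq_Ico]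
    refine Finset.prod_congr rfl fun j _ => ?_
    rw [Nat.div_div_eq_div_mul, add_comm 1 j, pow_succ']
  rw [hprod]
  induction k generalizing n with
  | zero => simp [pM_one hm n, Nat.ModEq]
  | succ k ih =>
    rw [pM_succ hm]
    refine (Nat.ModEq.sum fun i _ => ih i).trans ?_
    refine (sum_range_div_modEq hm
      (fun q => ∏ j ∈ Finset.range k, (q / m ^ j % m + 1)) (n / m)).trans ?_
    rw [Finset.prod_range_succ', pow_zero, Nat.div_one, mul_comm]
    simp only [Nat.div_div_eq_div_mul, pow_succ', mul_assoc]
    rfl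

/-- The residue modulo `4` of a product of numbers `f j + 1` with `f j < 4`. -/
theorem prod_add_one_mod_four {ι : Type*} (s : Finset ι) (f : ι → ℕ)
    (hf : ∀ j, f j < 4) :
    ((∏ j ∈ s, (f j + 1)) % 4 = 1 ↔
      (∀ j ∈ s, f j = 0 ∨ f j = 2) ∧ Even (s.filter (fun j => f j = 2)).card) ∧
    ((∏ j ∈ s, (f j + 1)) % 4 = 3 ↔
      (∀ j ∈ s, f j = 0 ∨ f j = 2) ∧ Odd (s.filter (fun j => f j = 2)).card) ∧
    ((∏ j ∈ s, (f j + 1)) % 4 = 2 ↔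
      (s.filter (fun j => f j = 1)).card = 1 ∧
      (∀ j ∈ s, f j ≠ 1 → f j = 0 ∨ f j = 2)) := by
  classical
  induction s using Finset.induction_on with
  | empty => simp
  | insert a s ha ih =>
    obtain ⟨ih1, ih3, ih2⟩ := ih
    have hzero : ((s.filter (fun j => f j = 1)).card = 0 ∧
        ∀ j ∈ s, f j ≠ 1 → f j = 0 ∨ f j = 2) ↔ ∀ j ∈ s, f j = 0 ∨ f j = 2 := by
      rw [Finset.card_eq_zero, Finset.filter_eq_empty_iff]
      grind
    rw [Finset.prod_insert ha, Nat.mul_mod]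
    have hlt := Nat.mod_lt (∏ j ∈ s, (f j + 1)) (show 4 > 0 by norm_num)
    generalize (∏ j ∈ s, (f j + 1)) % 4 = P at *
    have hcard (c : ℕ) : ((insert a s).filter (fun j => f j = c)).card =
        (s.filter (fun j => f j = c)).card + if f a = c then 1 else 0 := by
      rw [Finset.filter_insert]
      split_ifs with h
      · exact Finset.card_insert_of_notMem (by simp [ha])
      · rfl
    rw [hcard, hcard]
    simp only [Finset.forall_mem_insert]
    generalize (s.filter (fun j => f j = 2)).card = b at *
    generalize (s.filter (fun j => f j = 1)).card = c at *
    rw [Nat.even_iff] at ih1 ⊢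
    rw [Nat.odd_iff] at ih3 ⊢
    generalize (∀ j ∈ s, f j = 0 ∨ f j = 2) = A at *
    generalize (∀ j ∈ s, f j ≠ 1 → f j = 0 ∨ f j = 2) = B at *
    have := hf a
    generalize f a = d at *
    interval_cases d <;> interval_cases P <;> simp_all <;> grind

theorem stmt_11 (k : ℕ) (hk : 1 ≤ k) (n : ℕ) :
    (pM 4 k n % 4 = 1 ↔
      (∀ j ∈ Finset.Icc 1 (k - 1), n / 4 ^ j % 4 = 0 ∨ n / 4 ^ j % 4 = 2) ∧
      Even ((Finset.Icc 1 (k - 1)).filter (fun j => n / 4 ^ j % 4 = 2)).card) ∧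
    (pM 4 k n % 4 = 3 ↔
      (∀ j ∈ Finset.Icc 1 (k - 1), n / 4 ^ j % 4 = 0 ∨ n / 4 ^ j % 4 = 2) ∧
      Odd ((Finset.Icc 1 (k - 1)).filter (fun j => n / 4 ^ j % 4 = 2)).card) ∧
    (pM 4 k n % 4 = 2 ↔
      ((Finset.Icc 1 (k - 1)).filter (fun j => n / 4 ^ j % 4 = 1)).card = 1 ∧
      (∀ j ∈ Finset.Icc 1 (k - 1), n / 4 ^ j % 4 ≠ 1 →
        n / 4 ^ j % 4 = 0 ∨ n / 4 ^ j % 4 = 2)) := by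
  obtain ⟨k, rfl⟩ := Nat.exists_eq_add_of_le' hk
  rw [Nat.add_sub_cancel, show pM 4 (k + 1) n % 4 = _ from
    pM_modEq_prod_digits (by norm_num) k n]
  exact prod_add_one_mod_four (Finset.Icc 1 k) (fun j => n / 4 ^ j % 4)
    fun j => Nat.mod_lt _ (by norm_num)
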